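/- Consider a connected oriented graph on n nodes (n ≥ 2) and m arcs with oriented incidence matrix 𝔍, set μ = m − n + 1, and let B be a real μ×m matrix with 𝔍·Bᵀ = 0 and rank B = μ. Fix a distinguished node v_last, and for every other node i let x̄_i ∈ ℝ^m be the signed indicator vector of some walk from node i to node v_last. Fix a load vector d ∈ ℝ^n. Then the following two subsets of ℝ^m × ℝ^n × ℝ^n coincide: {(x, δ, u) | 𝔍·x = δ + u + d} = {(Bᵀ·z + Σ_{i ≠ v_last} (δ_i + u_i + d_i)·x̄_i, δ, u) | z ∈ ℝ^μ, δ ∈ ℝ^n, u ∈ ℝ^n, Σ_{i=1}^{n} (δ_i + u_i + d_i) = 0}. -/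

import Mathlib

/-- The oriented incidence matrix of an oriented graph given by `tail, head`. -/
def incMat (n m : ℕ) (tail head : Fin m → Fin n) : Matrix (Fin n) (Fin m) ℝ :=
  Matrix.of fun i j => if i = tail j then 1 else if i = head j then -1 else 0

/-- `x` is the signed indicator vector of a walk from `u` to `w`. -/
def IsWalkVec (n m : ℕ) (tail head : Fin m → Fin n) (u w : Fin n)
    (x : Fin m → ℝ) : Prop :=
  ∃ (k : ℕ) (v : Fin (k + 1) → Fin n) (a : Fin k → Fin m) (σ : Fin k → ℝ),
    v 0 = u ∧ v (Fin.last k) = w ∧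
    (∀ i : Fin k,
      (σ i = 1 ∧ tail (a i) = v i.castSucc ∧ head (a i) = v i.succ) ∨
      (σ i = -1 ∧ head (a i) = v i.castSucc ∧ tail (a i) = v i.succ)) ∧
    (∀ j : Fin m, x j = ∑ i : Fin k, if a i = j then σ i else 0)

/-- The oriented graph is connected: every pair of nodes is related by the
reflexive–transitive closure of "there is an arc between them". -/
def GraphConnected (n m : ℕ) (tail head : Fin m → Fin n) : Prop :=
  ∀ a b : Fin n, Relation.ReflTransGen
    (fun p q => ∃ j : Fin m, (tail j = p ∧ head j = q) ∨ (tail j = q ∧ head j = p)) a b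

theorem incMat_apply_eq_sub {n m : ℕ} {tail head : Fin m → Fin n}
    (hth : ∀ j, tail j ≠ head j) (p : Fin n) (j : Fin m) :
    incMat n m tail head p j =
      (if p = tail j then 1 else 0) - (if p = head j then 1 else 0) := by
  have h := hth j
  by_cases h1 : p = tail j
  · subst h1
    simp [incMat, h]
  · by_cases h2 : p = head j <;> simp [incMat, h1, h2, h.symm]

theorem sum_incMat_mulVec {n m : ℕ} {tail head : Fin m → Fin n}
    (hth : ∀ j, tail j ≠ head j) (x : Fin m → ℝ) :
    ∑ i, (incMat n m tail head).mulVec x i = 0 := by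
  simp only [Matrix.mulVec, dotProduct]
  rw [Finset.sum_comm]
  refine Finset.sum_eq_zero fun j _ => ?_
  rw [← Finset.sum_mul]
  simp [incMat_apply_eq_sub hth]

theorem Fin.sum_castSucc_sub_succ {k : ℕ} (f : Fin (k + 1) → ℝ) :
    ∑ i : Fin k, (f i.castSucc - f i.succ) = f 0 - f (Fin.last k) := by
  have h := (Fin.sum_univ_castSucc f).symm.trans (Fin.sum_univ_succ f)
  rw [Finset.sum_sub_distrib]
  linarith

/-- The boundary of a walk is its start node minus its end node. -/
theorem IsWalkVec.incMat_mulVec {n m : ℕ} {tail head : Fin m → Fin n}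
    (hth : ∀ j, tail j ≠ head j) {u w : Fin n} {x : Fin m → ℝ}
    (hx : IsWalkVec n m tail head u w x) (p : Fin n) :
    (incMat n m tail head).mulVec x p =
      (if p = u then 1 else 0) - (if p = w then 1 else 0) := by
  obtain ⟨k, v, a, σ, rfl, rfl, hstep, hx⟩ := hx
  rw [← Fin.sum_castSucc_sub_succ fun i => if p = v i then (1 : ℝ) else 0]
  simp only [Matrix.mulVec, dotProduct, hx, Finset.mul_sum]
  rw [Finset.sum_comm]
  refine Finset.sum_congr rfl fun i _ => ?_
  simp only [mul_ite, mul_zero, Finset.sum_ite_eq, Finset.mem_univ, if_true,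
    incMat_apply_eq_sub hth]
  rcases hstep i with ⟨hσ, ht, hh⟩ | ⟨hσ, hh, ht⟩ <;> rw [hσ, ht, hh] <;> ring

/-- Routing a balanced load along walks to a fixed node realizes that load. -/
theorem incMat_mulVec_sum_walks {n m : ℕ} {tail head : Fin m → Fin n}
    (hth : ∀ j, tail j ≠ head j) {w : Fin n} {xb : Fin n → Fin m → ℝ}
    (hxb : ∀ i, i ≠ w → IsWalkVec n m tail head i w (xb i))
    {b : Fin n → ℝ} (hb : ∑ i, b i = 0) :
    (incMat n m tail head).mulVec (∑ i ∈ Finset.univ.erase w, b i • xb i) = b := by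
  funext p
  rw [Matrix.mulVec_sum, Finset.sum_apply]
  have h : ∀ i ∈ Finset.univ.erase w, (incMat n m tail head).mulVec (b i • xb i) p =
      b i * ((if p = i then 1 else 0) - (if p = w then 1 else 0)) := by
    intro i hi
    rw [Matrix.mulVec_smul, Pi.smul_apply, smul_eq_mul,
      (hxb i (Finset.ne_of_mem_erase hi)).incMat_mulVec hth]
  rw [Finset.sum_congr rfl h, Finset.sum_erase _ (by simp)]
  simp [mul_sub, Finset.sum_sub_distrib, hb]

/-- If every node has a walk to a fixed node, the cycle space has dimension at most
`m - n + 1`. -/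
theorem finrank_ker_incMat_le {n m : ℕ} {tail head : Fin m → Fin n}
    (hth : ∀ j, tail j ≠ head j) {w : Fin n} {xb : Fin n → Fin m → ℝ}
    (hxb : ∀ i, i ≠ w → IsWalkVec n m tail head i w (xb i)) :
    Module.finrank ℝ (LinearMap.ker (incMat n m tail head).mulVecLin) ≤ m - n + 1 := by
  let s : (Fin n → ℝ) →ₗ[ℝ] ℝ := ∑ i, LinearMap.proj i
  have hle : LinearMap.ker s ≤ LinearMap.range (incMat n m tail head).mulVecLin := by
    intro b hb
    have hb' : ∑ i, b i = 0 := by simpa [s] using hb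
    exact ⟨_, incMat_mulVec_sum_walks hth hxb hb'⟩
  have h1 := Submodule.finrank_mono hle
  have h2 := s.finrank_range_add_finrank_ker
  have h3 := (LinearMap.range s).finrank_le
  have h4 := (incMat n m tail head).mulVecLin.finrank_range_add_finrank_ker
  simp only [Module.finrank_fin_fun, Module.finrank_self] at h2 h3 h4
  omega

/-- the set of triples `(x, δ, u)` with `𝔍·x = δ + u + d` coincides with
the set of triples `(Bᵀ·z + ∑_{i ≠ v_last} (δ_i + u_i + d_i)·x̄_i, δ, u)` with
`∑ (δ_i + u_i + d_i) = 0`. -/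
theorem flow_conservation_feasible_set_eq
    (n m : ℕ) (hn : 2 ≤ n) (hm : 1 ≤ m)
    (tail head : Fin m → Fin n) (hth : ∀ j : Fin m, tail j ≠ head j)
    (hconn : GraphConnected n m tail head)
    (μ : ℕ) (hμ : μ = m - n + 1)
    (B : Matrix (Fin μ) (Fin m) ℝ)
    (hB : incMat n m tail head * B.transpose = 0)
    (hrank : B.rank = μ)
    (vlast : Fin n) (xb : Fin n → Fin m → ℝ)
    (hxb : ∀ i : Fin n, i ≠ vlast → IsWalkVec n m tail head i vlast (xb i))
    (d : Fin n → ℝ) :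
    {p : (Fin m → ℝ) × (Fin n → ℝ) × (Fin n → ℝ) |
        (incMat n m tail head).mulVec p.1 = fun i => p.2.1 i + p.2.2 i + d i} =
    {p : (Fin m → ℝ) × (Fin n → ℝ) × (Fin n → ℝ) |
        (∃ z : Fin μ → ℝ,
          p.1 = B.transpose.mulVec z +
            ∑ i ∈ Finset.univ.erase vlast, (p.2.1 i + p.2.2 i + d i) • xb i) ∧
        ∑ i : Fin n, (p.2.1 i + p.2.2 i + d i) = 0} := by
  have hle : LinearMap.range B.transpose.mulVecLin ≤
      LinearMap.ker (incMat n m tail head).mulVecLin := by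
    rintro _ ⟨z, rfl⟩
    rw [LinearMap.mem_ker, Matrix.mulVecLin_apply, Matrix.mulVecLin_apply,
      Matrix.mulVec_mulVec, hB, Matrix.zero_mulVec]
  have hBrank : Module.finrank ℝ (LinearMap.range B.transpose.mulVecLin) = μ :=
    (Matrix.rank_transpose B).trans hrank
  have hker : LinearMap.range B.transpose.mulVecLin =
      LinearMap.ker (incMat n m tail head).mulVecLin :=
    Submodule.eq_of_le_of_finrank_le hle
      ((finrank_ker_incMat_le hth hxb).trans (by omega))
  ext ⟨x, δ, u⟩
  simp only [Set.mem_ofPred_eq]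
  constructor
  · intro h
    have hsum : ∑ i, (δ i + u i + d i) = 0 := by
      rw [← sum_incMat_mulVec hth x, h]
    refine ⟨?_, hsum⟩
    have hmem : x - ∑ i ∈ Finset.univ.erase vlast, (δ i + u i + d i) • xb i ∈
        LinearMap.range B.transpose.mulVecLin := by
      rw [hker, LinearMap.mem_ker, Matrix.mulVecLin_apply, Matrix.mulVec_sub, h,
        incMat_mulVec_sum_walks hth hxb hsum, sub_self]
    obtain ⟨z, hz⟩ := hmem
    exact ⟨z, sub_eq_iff_eq_add.mp hz.symm⟩
  · rintro ⟨⟨z, rfl⟩, hsum⟩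
    rw [Matrix.mulVec_add, Matrix.mulVec_mulVec, hB, Matrix.zero_mulVec, zero_add,
      incMat_mulVec_sum_walks hth hxb hsum]
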